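/- arXiv:2103.00647 — 2 statements merged into one kernel-verified Lean document; each statement's English description precedes it below -/
import Mathlib

section
/- Let G be a connected simple graph on n ≥ 2 vertices. Then ρ(D(G)) ≥ n − 1, with equality if and only if G is the complete graph K_n. -/
open Matrix BigOperators

/-- The distance matrix of a graph: the `(u,v)` entry is the graph distance from `u` to `v`. -/
noncomputable def distMatrix {V : Type*} [Fintype V] (G : SimpleGraph V) : Matrix V V ℝ :=
  Matrix.of fun u v => (G.dist u v : ℝ)

/-- The transmission of a vertex: the sum of the distances to all vertices. -/
noncomputable def transmission {V : Type*} [Fintype V] (G : SimpleGraph V) (v : V) : ℝ :=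
  ∑ u, (G.dist v u : ℝ)

/-- The distance signless Laplacian `D^Q(G) = T(G) + D(G)`. -/
noncomputable def distSignlessLap {V : Type*} [Fintype V] [DecidableEq V] (G : SimpleGraph V) :
    Matrix V V ℝ :=
  Matrix.diagonal (transmission G) + distMatrix G

/-- The distance Laplacian `D^L(G) = T(G) - D(G)`. -/
noncomputable def distLap {V : Type*} [Fintype V] [DecidableEq V] (G : SimpleGraph V) :
    Matrix V V ℝ :=
  Matrix.diagonal (transmission G) - distMatrix G

/-- The normalized distance Laplacian `D^NL(G) = T(G)^{-1/2} D^L(G) T(G)^{-1/2}`. -/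
noncomputable def normDistLap {V : Type*} [Fintype V] [DecidableEq V] (G : SimpleGraph V) :
    Matrix V V ℝ :=
  Matrix.diagonal (fun v => (Real.sqrt (transmission G v))⁻¹) * distLap G *
    Matrix.diagonal (fun v => (Real.sqrt (transmission G v))⁻¹)

/-- The spectral radius of a real matrix: the supremum of absolute values of its
(real) eigenvalues. -/
noncomputable def specRad {V : Type*} [Fintype V] [DecidableEq V] (M : Matrix V V ℝ) : ℝ :=
  sSup (abs '' spectrum ℝ M)

/-- The vector `e_u - e_v`. -/
noncomputable def signVec {V : Type*} [DecidableEq V] (u v : V) : V → ℝ :=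
  Pi.single u 1 - Pi.single v 1

theorem Matrix.IsHermitian.dotProduct_mulVec_le_specRad {V : Type*} [Fintype V] [DecidableEq V]
    {M : Matrix V V ℝ} (hM : M.IsHermitian) (x : V → ℝ) :
    x ⬝ᵥ (M *ᵥ x) ≤ specRad M * (x ⬝ᵥ x) := by
  have hfin : (spectrum ℝ M).Finite := Matrix.finite_real_spectrum
  have hpsd : (algebraMap ℝ (Matrix V V ℝ) (specRad M) - M).PosSemidef := by
    rw [Matrix.posSemidef_iff_isHermitian_and_spectrum_nonneg]
    refine ⟨?_, fun μ hμ => ?_⟩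
    · refine Matrix.IsHermitian.sub ?_ hM
      rw [Matrix.algebraMap_eq_diagonal]
      exact Matrix.isHermitian_diagonal _
    · rw [← spectrum.singleton_sub_eq, Set.singleton_sub] at hμ
      obtain ⟨ν, hν, rfl⟩ := hμ
      have : |ν| ≤ specRad M :=
        le_csSup (hfin.image abs).bddAbove (Set.mem_image_of_mem abs hν)
      exact sub_nonneg.2 ((le_abs_self ν).trans this)
  have h := hpsd.dotProduct_mulVec_nonneg x
  rw [Matrix.sub_mulVec, Algebra.algebraMap_eq_smul_one, Matrix.smul_mulVec, Matrix.one_mulVec,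
    dotProduct_sub, dotProduct_smul] at h
  simpa using h

theorem distMatrix_isHermitian {V : Type*} [Fintype V] (G : SimpleGraph V) :
    (distMatrix G).IsHermitian := by
  ext u v
  simp [distMatrix, SimpleGraph.dist_comm]

/-- The average transmission of a graph is at most the spectral radius of its distance matrix. -/
theorem sum_transmission_le_specRad {V : Type*} [Fintype V] [DecidableEq V] (G : SimpleGraph V) :
    ∑ v, transmission G v ≤ specRad (distMatrix G) * Fintype.card V := by
  simpa [dotProduct, Matrix.mulVec, distMatrix, transmission] using
    (distMatrix_isHermitian G).dotProduct_mulVec_le_specRad (fun _ => 1)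

theorem sum_ite_ne_eq_card_sub_one {V : Type*} [Fintype V] [DecidableEq V] (u : V) :
    ∑ v, (if u = v then (0 : ℝ) else 1) = Fintype.card V - 1 := by
  have h : ∀ v, (if u = v then (0 : ℝ) else 1) = 1 - if u = v then 1 else 0 := by
    intro v; split_ifs <;> simp
  simp [h]

theorem SimpleGraph.Connected.ite_ne_le_dist {V : Type*} [DecidableEq V] {G : SimpleGraph V}
    (hG : G.Connected) (u v : V) : (if u = v then (0 : ℝ) else 1) ≤ G.dist u v := by
  split_ifs with h
  · positivity
  · exact_mod_cast hG.pos_dist_of_ne h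

theorem SimpleGraph.Connected.card_sub_one_le_transmission {V : Type*} [Fintype V]
    {G : SimpleGraph V} (hG : G.Connected) (u : V) :
    (Fintype.card V : ℝ) - 1 ≤ transmission G u := by
  classical
  rw [← sum_ite_ne_eq_card_sub_one u]
  exact Finset.sum_le_sum fun v _ => hG.ite_ne_le_dist u v

theorem SimpleGraph.Connected.card_sub_one_lt_transmission {V : Type*} [Fintype V]
    {G : SimpleGraph V} (hG : G.Connected) {u v : V} (huv : u ≠ v) (hadj : ¬ G.Adj u v) :
    (Fintype.card V : ℝ) - 1 < transmission G u := by
  classical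
  rw [← sum_ite_ne_eq_card_sub_one u]
  refine Finset.sum_lt_sum (fun w _ => hG.ite_ne_le_dist u w) ⟨v, Finset.mem_univ v, ?_⟩
  have h1 : G.dist u v ≠ 1 := fun h => hadj (SimpleGraph.dist_eq_one_iff_adj.1 h)
  have h0 := hG.pos_dist_of_ne huv
  rw [if_neg huv]
  exact_mod_cast (by omega : 1 < G.dist u v)

theorem SimpleGraph.Connected.card_sub_one_le_specRad_distMatrix {V : Type*} [Fintype V]
    [DecidableEq V] {G : SimpleGraph V} (hG : G.Connected) :
    (Fintype.card V : ℝ) - 1 ≤ specRad (distMatrix G) := by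
  have := hG.nonempty
  have hpos : (0 : ℝ) < Fintype.card V := by exact_mod_cast Fintype.card_pos
  refine le_of_mul_le_mul_right (le_trans ?_ (sum_transmission_le_specRad G)) hpos
  have h := Finset.sum_le_sum fun u (_ : u ∈ Finset.univ) => hG.card_sub_one_le_transmission u
  rw [Finset.sum_const, nsmul_eq_mul, Finset.card_univ, mul_comm] at h
  exact h

theorem SimpleGraph.Connected.card_sub_one_lt_specRad_distMatrix {V : Type*} [Fintype V]
    [DecidableEq V] {G : SimpleGraph V} (hG : G.Connected) (htop : G ≠ ⊤) :
    (Fintype.card V : ℝ) - 1 < specRad (distMatrix G) := by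
  have := hG.nonempty
  have hpos : (0 : ℝ) < Fintype.card V := by exact_mod_cast Fintype.card_pos
  obtain ⟨u, v, huv, hadj⟩ := SimpleGraph.ne_top_iff_exists_not_adj.1 htop
  refine lt_of_mul_lt_mul_right (lt_of_lt_of_le ?_ (sum_transmission_le_specRad G)) hpos.le
  have h := Finset.sum_lt_sum (fun w (_ : w ∈ Finset.univ) => hG.card_sub_one_le_transmission w)
    ⟨u, Finset.mem_univ u, hG.card_sub_one_lt_transmission huv hadj⟩
  rw [Finset.sum_const, nsmul_eq_mul, Finset.card_univ, mul_comm] at h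
  exact h

theorem distMatrix_top_mulVec {V : Type*} [Fintype V] (x : V → ℝ) (u : V) :
    (distMatrix (⊤ : SimpleGraph V) *ᵥ x) u = ∑ v, x v - x u := by
  classical
  have h : ∀ v, ((⊤ : SimpleGraph V).dist u v : ℝ) * x v = x v - if u = v then x v else 0 := by
    intro v
    rw [SimpleGraph.dist_top]
    split_ifs <;> simp
  simp [Matrix.mulVec, dotProduct, distMatrix, h]

theorem eq_neg_one_or_eq_of_mem_spectrum_distMatrix_top {V : Type*} [Fintype V] [DecidableEq V]
    {μ : ℝ} (hμ : μ ∈ spectrum ℝ (distMatrix (⊤ : SimpleGraph V))) :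
    μ = -1 ∨ μ = (Fintype.card V : ℝ) - 1 := by
  rw [← Matrix.spectrum_toLin', ← Module.End.hasEigenvalue_iff_mem_spectrum] at hμ
  obtain ⟨x, hx⟩ := hμ.exists_hasEigenvector
  have hev : ∀ u, ∑ v, x v = (μ + 1) * x u := fun u => by
    have h := congrFun hx.apply_eq_smul u
    rw [Matrix.toLin'_apply, distMatrix_top_mulVec, Pi.smul_apply, smul_eq_mul] at h
    linarith
  obtain ⟨u, hu⟩ := Function.ne_iff.1 hx.2
  have hsum : (Fintype.card V : ℝ) * ∑ v, x v = (μ + 1) * ∑ v, x v := by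
    rw [Finset.mul_sum (a := μ + 1), ← Finset.sum_congr rfl fun u _ => hev u]
    simp
  by_cases hS : ∑ v, x v = 0
  · left
    have h := hev u
    rw [hS, eq_comm, mul_eq_zero] at h
    linarith [h.resolve_right hu]
  · right
    linarith [mul_right_cancel₀ hS hsum]

theorem specRad_distMatrix_top_le {V : Type*} [Fintype V] [DecidableEq V]
    (hV : 2 ≤ Fintype.card V) :
    specRad (distMatrix (⊤ : SimpleGraph V)) ≤ (Fintype.card V : ℝ) - 1 := by
  have hV' : (2 : ℝ) ≤ Fintype.card V := by exact_mod_cast hV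
  refine Real.sSup_le ?_ (by linarith)
  rintro _ ⟨μ, hμ, rfl⟩
  rcases eq_neg_one_or_eq_of_mem_spectrum_distMatrix_top hμ with rfl | rfl
  · rw [abs_neg, abs_one]
    linarith
  · rw [abs_of_nonneg (by linarith)]

/-- For a connected graph on `n ≥ 2` vertices, the spectral radius of the distance matrix is
at least `n - 1`, with equality if and only if the graph is complete. -/
theorem specRad_distMatrix_ge_of_connected {n : ℕ} (hn : 2 ≤ n) (G : SimpleGraph (Fin n))
    (hG : G.Connected) :
    (n : ℝ) - 1 ≤ specRad (distMatrix G) ∧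
    (specRad (distMatrix G) = (n : ℝ) - 1 ↔ G = ⊤) := by
  have hle := hG.card_sub_one_le_specRad_distMatrix
  rw [Fintype.card_fin] at hle
  refine ⟨hle, fun heq => ?_, ?_⟩
  · by_contra htop
    have hlt := hG.card_sub_one_lt_specRad_distMatrix htop
    rw [Fintype.card_fin] at hlt
    exact hlt.ne' heq
  · rintro rfl
    have hge := specRad_distMatrix_top_le (V := Fin n) (by simpa using hn)
    rw [Fintype.card_fin] at hge
    exact hge.antisymm hle
end

section
/- Let G be a connected simple graph on n ≥ 2 vertices. Then ρ(D^NL(G)) ≤ 2, and if n ≥ 3, then ρ(D^NL(G)) < 2. -/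
open Matrix BigOperators

section Transmission

variable {V : Type*} [Fintype V] {G : SimpleGraph V}

theorem transmission_pos [Nontrivial V] (hG : G.Connected) (v : V) : 0 < transmission G v := by
  obtain ⟨u, hu⟩ := exists_ne v
  exact Finset.sum_pos' (fun _ _ => Nat.cast_nonneg _)
    ⟨u, Finset.mem_univ u, Nat.cast_pos.2 (hG.pos_dist_of_ne hu.symm)⟩

theorem sum_dist_mul_add (y : V → ℝ) (v : V) (c : ℝ) :
    ∑ u, (G.dist v u : ℝ) * (c + y u) = transmission G v * c + ∑ u, (G.dist v u : ℝ) * y u := by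
  simp only [transmission, mul_add, Finset.sum_add_distrib, Finset.sum_mul]

theorem sum_dist_mul_sub (y : V → ℝ) (v : V) (c : ℝ) :
    ∑ u, (G.dist v u : ℝ) * (c - y u) = transmission G v * c - ∑ u, (G.dist v u : ℝ) * y u := by
  simp only [transmission, mul_sub, Finset.sum_sub_distrib, Finset.sum_mul]

/-- At a coordinate of maximal modulus, `D y = (1 - μ) T y` forces `0 ≤ μ ≤ 2`. -/
theorem mem_Icc_of_sum_dist_mul_eq [Nontrivial V] (hG : G.Connected) {μ : ℝ} {y : V → ℝ} {v : V}
    (hv : 0 < y v) (hmax : ∀ u, |y u| ≤ y v)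
    (h : ∑ u, (G.dist v u : ℝ) * y u = (1 - μ) * (transmission G v * y v)) :
    μ ∈ Set.Icc 0 2 := by
  have hpos := mul_pos (transmission_pos hG v) hv
  have h₁ := sum_dist_mul_add (G := G) y v (y v)
  have h₂ := sum_dist_mul_sub (G := G) y v (y v)
  have h₃ : 0 ≤ ∑ u, (G.dist v u : ℝ) * (y v + y u) := Finset.sum_nonneg fun u _ =>
    mul_nonneg (Nat.cast_nonneg _) (by linarith [neg_le_of_abs_le (hmax u)])
  have h₄ : 0 ≤ ∑ u, (G.dist v u : ℝ) * (y v - y u) := Finset.sum_nonneg fun u _ =>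
    mul_nonneg (Nat.cast_nonneg _) (by linarith [le_of_abs_le (hmax u)])
  constructor <;> nlinarith

/-- If `D y = -T y` at a coordinate of maximal modulus, all other coordinates are opposite to it. -/
theorem eq_neg_of_sum_dist_mul_eq (hG : G.Connected) {y : V → ℝ} {v : V}
    (hmax : ∀ u, |y u| ≤ y v)
    (h : ∑ u, (G.dist v u : ℝ) * y u = -(transmission G v * y v)) {u : V} (hu : u ≠ v) :
    y u = -y v := by
  have hsum : ∑ u, (G.dist v u : ℝ) * (y v + y u) = 0 := by
    rw [sum_dist_mul_add, h, add_neg_cancel]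
  have hnn : ∀ u ∈ Finset.univ, 0 ≤ (G.dist v u : ℝ) * (y v + y u) := fun u _ =>
    mul_nonneg (Nat.cast_nonneg _) (by linarith [neg_le_of_abs_le (hmax u)])
  have h₀ := (Finset.sum_eq_zero_iff_of_nonneg hnn).1 hsum u (Finset.mem_univ u)
  have hd : (G.dist v u : ℝ) ≠ 0 := Nat.cast_ne_zero.2 (hG.pos_dist_of_ne hu.symm).ne'
  linarith [(mul_eq_zero.1 h₀).resolve_left hd]

variable [DecidableEq V]

/-- An eigenvalue of the normalized distance Laplacian solves the generalized eigenvalue problem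
`D y = (1 - μ) T y`. -/
theorem exists_generalized_eigenvector [Nontrivial V] (hG : G.Connected) {μ : ℝ}
    (hμ : μ ∈ spectrum ℝ (normDistLap G)) :
    ∃ y : V → ℝ, y ≠ 0 ∧
      ∀ v, ∑ u, (G.dist v u : ℝ) * y u = (1 - μ) * (transmission G v * y v) := by
  rw [← Matrix.spectrum_toLin', ← Module.End.hasEigenvalue_iff_mem_spectrum] at hμ
  obtain ⟨x, hx⟩ := hμ.exists_hasEigenvector
  have hs (v : V) : 0 < √(transmission G v) := Real.sqrt_pos.2 (transmission_pos hG v)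
  refine ⟨fun v => (√(transmission G v))⁻¹ * x v, fun h => hx.2 ?_, fun v => ?_⟩
  · ext v
    simpa [(hs v).ne'] using congrFun h v
  · have h := congrFun hx.apply_eq_smul v
    have hdiag : Matrix.diagonal (fun v => (√(transmission G v))⁻¹) *ᵥ x =
        fun v => (√(transmission G v))⁻¹ * x v := funext (Matrix.mulVec_diagonal _ _)
    rw [Matrix.toLin'_apply, normDistLap, ← Matrix.mulVec_mulVec, ← Matrix.mulVec_mulVec, hdiag,
      Matrix.mulVec_diagonal, distLap, Matrix.sub_mulVec, Pi.sub_apply, Matrix.mulVec_diagonal,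
      Pi.smul_apply, smul_eq_mul, inv_mul_eq_iff_eq_mul₀ (hs v).ne'] at h
    simp only [distMatrix, Matrix.mulVec, dotProduct, Matrix.of_apply] at h
    have hx : √(transmission G v) * (μ * x v) =
        μ * (transmission G v * ((√(transmission G v))⁻¹ * x v)) := by
      nth_rewrite 2 [← Real.mul_self_sqrt (transmission_pos hG v).le]
      field_simp [(hs v).ne']
    linarith

/-- The eigenvector can be normalized so that a coordinate of maximal modulus is positive. -/
theorem exists_generalized_eigenvector_max [Nontrivial V] (hG : G.Connected) {μ : ℝ}
    (hμ : μ ∈ spectrum ℝ (normDistLap G)) :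
    ∃ (y : V → ℝ) (v : V), 0 < y v ∧ (∀ u, |y u| ≤ y v) ∧
      ∀ w, ∑ u, (G.dist w u : ℝ) * y u = (1 - μ) * (transmission G w * y w) := by
  obtain ⟨y, hy, h⟩ := exists_generalized_eigenvector hG hμ
  obtain ⟨v, hv⟩ := Finite.exists_max fun u => |y u|
  have hyv : y v ≠ 0 := fun h₀ => hy <| funext fun u =>
    abs_nonpos_iff.1 <| by simpa [h₀] using hv u
  rcases hyv.lt_or_gt with hneg | hpos
  · refine ⟨-y, v, by simpa using hneg, fun u => ?_, fun w => ?_⟩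
    · simpa [abs_of_neg hneg] using hv u
    · simp [h w]
  · exact ⟨y, v, hpos, fun u => by simpa [abs_of_pos hpos] using hv u, h⟩

theorem spectrum_normDistLap_subset_Icc [Nontrivial V] (hG : G.Connected) :
    spectrum ℝ (normDistLap G) ⊆ Set.Icc 0 2 := fun _ hμ => by
  obtain ⟨y, v, hv, hmax, h⟩ := exists_generalized_eigenvector_max hG hμ
  exact mem_Icc_of_sum_dist_mul_eq hG hv hmax (h v)

theorem two_notMem_spectrum_normDistLap (hV : 3 ≤ Fintype.card V) (hG : G.Connected) :
    2 ∉ spectrum ℝ (normDistLap G) := fun h2 => by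
  have : Nontrivial V := Fintype.one_lt_card_iff_nontrivial.1 (by omega)
  obtain ⟨y, v, hv, hmax, h⟩ := exists_generalized_eigenvector_max hG h2
  obtain ⟨u, hu⟩ := exists_ne v
  obtain ⟨w, hwu, hwv⟩ : ∃ w, w ≠ u ∧ w ≠ v := by
    obtain ⟨w, hw⟩ := Finset.exists_mem_notMem_of_card_lt_card
      (s := {u, v}) (t := Finset.univ) (Finset.card_le_two.trans_lt hV)
    exact ⟨w, by simpa using hw⟩
  have hyu : y u = -y v := eq_neg_of_sum_dist_mul_eq hG hmax (by linarith [h v]) hu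
  have hyw : y w = -y v := eq_neg_of_sum_dist_mul_eq hG hmax (by linarith [h v]) hwv
  have hyw' : (-y) w = -(-y) u := by
    refine eq_neg_of_sum_dist_mul_eq hG (fun x => ?_) ?_ hwu
    · simpa [hyu] using hmax x
    · simp only [Pi.neg_apply, mul_neg, Finset.sum_neg_distrib]
      linarith [h u]
  simp only [Pi.neg_apply] at hyw'
  linarith

end Transmission

/-- For a connected graph on `n ≥ 2` vertices, the spectral radius of the normalized
distance Laplacian is at most `2`, and it is strictly less than `2` when `n ≥ 3`. -/
theorem specRad_normDistLap_le_two {n : ℕ} (hn : 2 ≤ n) (G : SimpleGraph (Fin n))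
    (hG : G.Connected) :
    specRad (normDistLap G) ≤ 2 ∧ (3 ≤ n → specRad (normDistLap G) < 2) := by
  have : Nontrivial (Fin n) := Fin.nontrivial_iff_two_le.2 hn
  have hsub := spectrum_normDistLap_subset_Icc hG
  have habs : ∀ μ ∈ spectrum ℝ (normDistLap G), |μ| = μ := fun μ hμ => abs_of_nonneg (hsub hμ).1
  refine ⟨Real.sSup_le ?_ zero_le_two, fun h3 => ?_⟩
  · rintro _ ⟨μ, hμ, rfl⟩
    exact (habs μ hμ).trans_le (hsub hμ).2
  · rcases (abs '' spectrum ℝ (normDistLap G)).eq_empty_or_nonempty with he | hne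
    · simp [specRad, he]
    · refine (((Matrix.finite_real_spectrum (A := normDistLap G)).image abs).csSup_lt_iff hne).2 ?_
      rintro _ ⟨μ, hμ, rfl⟩
      refine (habs μ hμ).trans_lt ((hsub hμ).2.lt_of_ne ?_)
      rintro rfl
      exact two_notMem_spectrum_normDistLap (by simpa using h3) hG hμ
end
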